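/- Consequences of Hamming (n,ℓ,σ)-equivalence for the constacyclic constants. Let 0 < ℓ < n be integers and let a₀, a_ℓ, b₀, b_ℓ be nonzero elements of 𝔽_q. Suppose there exists a nonzero α ∈ 𝔽_q with a₀·N_n^σ(α) = b₀ and a_ℓ·N_{n−ℓ}^σ(σ^ℓ(α)) = b_ℓ. Then for each i ∈ {0, ℓ}: (i) a_i^{−1}·b_i belongs to the cyclic subgroup of 𝔽_q^* generated by N_{n−i}^σ(σ^{i}(ξ)); and (ii) (a_i^{−1}·b_i)^{d_i} = 1, where d_i := (q−1)/gcd([n−i]_r, q−1). -/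

import Mathlib

/-- `sNorm σ i α = σ^{i-1}(α) ⋯ σ(α) · α`, the `i`-th skew norm of `α`. -/
def sNorm {F : Type*} [Field F] (σ : F ≃+* F) (i : ℕ) (α : F) : F :=
  ∏ j ∈ Finset.range i, (⇑σ)^[j] α

/-- `brk p r i = [i]_r = 1 + p^r + ⋯ + p^{r(i-1)} = (p^{ri} - 1)/(p^r - 1)`. -/
def brk (p r i : ℕ) : ℕ := ∑ j ∈ Finset.range i, p ^ (r * j)

theorem iterate_apply_pow {F : Type*} [Field F] (σ : F ≃+* F) (j : ℕ) (x : F) (m : ℕ) :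
    (⇑σ)^[j] (x ^ m) = ((⇑σ)^[j] x) ^ m := by
  induction j with
  | zero => rfl
  | succ j ih => rw [Function.iterate_succ_apply', Function.iterate_succ_apply', ih, map_pow]

theorem iterate_apply_ne_zero {F : Type*} [Field F] (σ : F ≃+* F) (j : ℕ) {x : F} (hx : x ≠ 0) :
    (⇑σ)^[j] x ≠ 0 := by
  induction j with
  | zero => exact hx
  | succ j ih =>
    rw [Function.iterate_succ_apply']
    exact (map_ne_zero σ).2 ih

theorem sNorm_pow {F : Type*} [Field F] (σ : F ≃+* F) (i : ℕ) (x : F) (m : ℕ) :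
    sNorm σ i (x ^ m) = sNorm σ i x ^ m := by
  simp only [sNorm, iterate_apply_pow, Finset.prod_pow]

theorem sNorm_eq_pow_brk {F : Type*} [Field F] {p r : ℕ} {σ : F ≃+* F}
    (hσ : ∀ a : F, σ a = a ^ p ^ r) (i : ℕ) (x : F) : sNorm σ i x = x ^ brk p r i := by
  have iterate_eq (j : ℕ) : (⇑σ)^[j] x = x ^ p ^ (r * j) := by
    induction j with
    | zero => simp
    | succ j ih => rw [Function.iterate_succ_apply', ih, hσ, ← pow_mul, ← pow_add, Nat.mul_succ]
  simp only [sNorm, brk, iterate_eq, Finset.prod_pow_eq_pow_sum]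

theorem pow_pow_div_gcd_eq_one {M : Type*} [Monoid M] {x : M} {N : ℕ} (hx : x ^ N = 1) (k : ℕ) :
    (x ^ k) ^ (N / Nat.gcd k N) = 1 := by
  rw [← pow_mul, ← Nat.mul_div_assoc _ (Nat.gcd_dvd_right k N), mul_comm,
    Nat.mul_div_assoc _ (Nat.gcd_dvd_left k N), pow_mul, hx, one_pow]

/-- Consequences of Hamming `(n,ℓ,σ)`-equivalence for the constacyclic constants. -/
theorem hamming_equiv_constacyclic_consequences
    (p s r : ℕ) (hp : p.Prime) (hs : 1 ≤ s) (hr : r < s)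
    (F : Type*) [Field F] [Fintype F] (hF : Fintype.card F = p ^ s)
    (σ : F ≃+* F) (hσ : ∀ a : F, σ a = a ^ p ^ r)
    (ξ : F) (hξ0 : ξ ≠ 0) (hξ : ∀ x : F, x ≠ 0 → ∃ m : ℕ, x = ξ ^ m)
    (ℓ n : ℕ) (hℓ : 0 < ℓ) (hℓn : ℓ < n)
    (a₀ aℓ b₀ bℓ : F) (ha₀ : a₀ ≠ 0) (haℓ : aℓ ≠ 0) (hb₀ : b₀ ≠ 0) (hbℓ : bℓ ≠ 0)
    (heq : ∃ α : F, α ≠ 0 ∧ a₀ * sNorm σ n α = b₀ ∧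
      aℓ * sNorm σ (n - ℓ) ((⇑σ)^[ℓ] α) = bℓ) :
    (∃ m : ℕ, a₀⁻¹ * b₀ = (sNorm σ n ξ) ^ m) ∧
    (∃ m : ℕ, aℓ⁻¹ * bℓ = (sNorm σ (n - ℓ) ((⇑σ)^[ℓ] ξ)) ^ m) ∧
    (a₀⁻¹ * b₀) ^ ((p ^ s - 1) / Nat.gcd (brk p r n) (p ^ s - 1)) = 1 ∧
    (aℓ⁻¹ * bℓ) ^ ((p ^ s - 1) / Nat.gcd (brk p r (n - ℓ)) (p ^ s - 1)) = 1 := by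
  obtain ⟨α, hα, rfl, rfl⟩ := heq
  rw [inv_mul_cancel_left₀ ha₀, inv_mul_cancel_left₀ haℓ]
  have pow_card_sub_one {x : F} (hx : x ≠ 0) : x ^ (p ^ s - 1) = 1 :=
    hF ▸ FiniteField.pow_card_sub_one_eq_one x hx
  refine ⟨?_, ?_, ?_, ?_⟩
  · obtain ⟨m, rfl⟩ := hξ α hα
    exact ⟨m, sNorm_pow σ n ξ m⟩
  · obtain ⟨m, rfl⟩ := hξ α hα
    exact ⟨m, by rw [iterate_apply_pow, sNorm_pow]⟩
  · rw [sNorm_eq_pow_brk hσ]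
    exact pow_pow_div_gcd_eq_one (pow_card_sub_one hα) _
  · rw [sNorm_eq_pow_brk hσ]
    exact pow_pow_div_gcd_eq_one (pow_card_sub_one (iterate_apply_ne_zero σ ℓ hα)) _
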